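/- Let K be an algebraically closed field and n ≥ 3. Then the quotient Õ_{1,2,n}/O_{1,2,n} of the normalization of the coordinate ring of the Kalman variety K_{1,2,n} by the coordinate ring itself is isomorphic, as an A-module, to O_{2,2,n} = A/I_{2,2,n} (in the paper this isomorphism is graded after a degree shift by 1); equivalently, there is an exact sequence of A-modules 0 → O_{1,2,n} → Õ_{1,2,n} → O_{2,2,n} → 0 whose first map is the inclusion of O_{1,2,n} into its integral closure. -/

import Mathlib

set_option synthInstance.maxHeartbeats 1000000
set_option maxHeartbeats 4000000

open Matrix

/-- The span of the first `d` standard basis vectors of `K^n`. -/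
def firstCoordsSubspace (K : Type*) [Field K] (n d : ℕ) : Submodule K (Fin n → K) where
  carrier := {v | ∀ i : Fin n, d ≤ (i : ℕ) → v i = 0}
  add_mem' := fun hv hw i hi => by simp [hv i hi, hw i hi]
  zero_mem' := fun i _ => rfl
  smul_mem' := fun c v hv i hi => by simp [hv i hi]

/-- The Kalman variety `K_{s,d,n}`: matrices having an `s`-dimensional invariant
subspace contained in the span `L` of the first `d` standard basis vectors. -/
def kalmanSet (K : Type*) [Field K] (n d s : ℕ) : Set (Matrix (Fin n) (Fin n) K) :=
  {M | ∃ U : Submodule K (Fin n → K), U ≤ firstCoordsSubspace K n d ∧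
    Module.finrank K U = s ∧ ∀ v ∈ U, M.mulVec v ∈ U}

/-- The upper-left `d × d` block `α` of an `n × n` matrix. -/
def alphaBlock {K : Type*} [Field K] {n : ℕ} (d : ℕ) (h : d ≤ n)
    (M : Matrix (Fin n) (Fin n) K) : Matrix (Fin d) (Fin d) K :=
  fun i j => M (Fin.castLE h i) (Fin.castLE h j)

/-- The lower-left `(n-d) × d` block `γ` of an `n × n` matrix. -/
def gammaBlock {K : Type*} [Field K] {n : ℕ} (d : ℕ) (h : d ≤ n)
    (M : Matrix (Fin n) (Fin n) K) : Matrix (Fin (n - d)) (Fin d) K :=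
  fun i j => M ⟨d + (i : ℕ), by have := i.isLt; omega⟩ (Fin.castLE h j)

/-- The reduced Kalman matrix: the `d(n-d) × d` matrix obtained by stacking
`γ, γα, γα², …, γα^{d-1}`; row `(k, i)` is row `i` of the block `γ * α^k`. -/
def redKalman {K : Type*} [Field K] {n : ℕ} (d : ℕ) (h : d ≤ n)
    (M : Matrix (Fin n) (Fin n) K) : Matrix (Fin d × Fin (n - d)) (Fin d) K :=
  fun p j => (gammaBlock d h M * (alphaBlock d h M) ^ (p.1 : ℕ)) p.2 j

/-- The vanishing ideal of a set of `n × n` matrices, inside the polynomial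
coordinate ring `A = K[x_{ij}]` of the matrix space. -/
def matVanishingIdeal (K : Type*) [Field K] (n : ℕ)
    (S : Set (Matrix (Fin n) (Fin n) K)) : Ideal (MvPolynomial (Fin n × Fin n) K) where
  carrier := {f | ∀ M ∈ S, MvPolynomial.eval (fun p => M p.1 p.2) f = 0}
  add_mem' := fun ha hb M hM => by simp [ha M hM, hb M hM]
  zero_mem' := fun M hM => by simp
  smul_mem' := fun c f hf M hM => by simp [smul_eq_mul, hf M hM]

/-- The coordinate ring `A` of the space of `n × n` matrices. -/
abbrev MatCoordRing (K : Type*) [Field K] (n : ℕ) := MvPolynomial (Fin n × Fin n) K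

/-- The vanishing ideal `I_{s,d,n}` of the Kalman variety. -/
noncomputable def kalmanIdeal (K : Type*) [Field K] (n d s : ℕ) :
    Ideal (MatCoordRing K n) :=
  matVanishingIdeal K n (kalmanSet K n d s)

/-- The irrelevant (maximal graded) ideal `A₊` of the polynomial ring,
generated by all the variables. -/
noncomputable def irrelevantIdeal (K : Type*) [Field K] (n : ℕ) :
    Ideal (MatCoordRing K n) :=
  Ideal.span (Set.range MvPolynomial.X)

/-- The coordinate ring `O_{s,d,n} = A/I_{s,d,n}` of the Kalman variety. -/
abbrev KalmanCoordRing (K : Type*) [Field K] (n d s : ℕ) :=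
  MatCoordRing K n ⧸ kalmanIdeal K n d s

/-- The normalization `Õ_{s,d,n}`: the integral closure of `O_{s,d,n}` in its
total ring of fractions (which is its field of fractions when `O_{s,d,n}` is a
domain, e.g. when `K` is algebraically closed). -/
def KalmanNormalization (K : Type*) [Field K] (n d s : ℕ) : Type _ :=
  ↥(integralClosure (KalmanCoordRing K n d s) (FractionRing (KalmanCoordRing K n d s)))

noncomputable instance (K : Type*) [Field K] (n d s : ℕ) :
    CommRing (KalmanNormalization K n d s) :=
  Subalgebra.toCommRing (R := KalmanCoordRing K n d s)
    (A := FractionRing (KalmanCoordRing K n d s)) (integralClosure _ _)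

noncomputable instance (K : Type*) [Field K] (n d s : ℕ) :
    Algebra (KalmanCoordRing K n d s) (KalmanNormalization K n d s) :=
  Subalgebra.algebra (R := KalmanCoordRing K n d s)
    (A := FractionRing (KalmanCoordRing K n d s)) (integralClosure _ _)

noncomputable instance (K : Type*) [Field K] (n d s : ℕ) :
    Algebra (MatCoordRing K n) (KalmanNormalization K n d s) :=
  ((algebraMap (KalmanCoordRing K n d s) (KalmanNormalization K n d s)).comp
    (algebraMap (MatCoordRing K n) (KalmanCoordRing K n d s))).toAlgebra

instance (K : Type*) [Field K] (n d s : ℕ) :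
    IsScalarTower (MatCoordRing K n) (KalmanCoordRing K n d s)
      (KalmanNormalization K n d s) :=
  IsScalarTower.of_algebraMap_eq' (R := MatCoordRing K n)
    (S := KalmanCoordRing K n d s) (A := KalmanNormalization K n d s) rfl

noncomputable instance (K : Type*) [Field K] (n d s : ℕ) :
    Algebra K (KalmanNormalization K n d s) :=
  ((algebraMap (KalmanCoordRing K n d s) (KalmanNormalization K n d s)).comp
    (algebraMap K (KalmanCoordRing K n d s))).toAlgebra

instance (K : Type*) [Field K] (n d s : ℕ) :
    IsScalarTower K (MatCoordRing K n) (KalmanNormalization K n d s) :=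
  IsScalarTower.of_algebraMap_eq fun x => by
    show algebraMap (KalmanCoordRing K n d s) _ (algebraMap K _ x) =
      algebraMap (KalmanCoordRing K n d s) _
        (algebraMap (MatCoordRing K n) _ (algebraMap K (MatCoordRing K n) x))
    rw [← IsScalarTower.algebraMap_apply K (MatCoordRing K n) (KalmanCoordRing K n d s)]

/-- The inclusion of `O_{s,d,n}` into its normalization `Õ_{s,d,n}`,
as an `A`-module map. -/
noncomputable def kalmanNormInclusion (K : Type*) [Field K] (n d s : ℕ) :
    KalmanCoordRing K n d s →ₗ[MatCoordRing K n] KalmanNormalization K n d s :=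
  (IsScalarTower.toAlgHom (MatCoordRing K n) (KalmanCoordRing K n d s)
    (KalmanNormalization K n d s)).toLinearMap

/-- The elements of the integral closure of a domain `O`, embedded in an integrally closed domain
`R`, are the `a + b l` with `a b : O`, once `l` is an integral element of the fraction field of `O`
such that every element of `R` that is a quotient of elements of `O` has this form. -/
theorem exists_integralClosure_generator {O R : Type*} [CommRing O] [IsDomain O] [CommRing R]
    [IsDomain R] [IsIntegrallyClosed R] (j : O →+* R) (hj : Function.Injective j) (l : R)
    (x y t d : O) (hy : y ≠ 0) (hxy : j y * l = j x) (hl : l ^ 2 - j t * l + j d = 0)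
    (hB : ∀ (r : R) (p q : O), q ≠ 0 → r * j q = j p → ∃ a b, r = j a + l * j b) :
    ∃ e : FractionRing O, e ∈ integralClosure O (FractionRing O) ∧
      (∀ z ∈ integralClosure O (FractionRing O), ∃ a b : O,
        z = algebraMap O (FractionRing O) a + algebraMap O (FractionRing O) b * e) ∧
      ∀ a b : O, algebraMap O (FractionRing O) a + algebraMap O (FractionRing O) b * e = 0 ↔
        j a + l * j b = 0 := by
  have hR : Function.Injective (algebraMap R (FractionRing R)) :=
    IsFractionRing.injective R (FractionRing R)
  have hg : Function.Injective ((algebraMap R (FractionRing R)).comp j) := by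
    rw [RingHom.coe_comp]
    exact hR.comp hj
  let ι : FractionRing O →+* FractionRing R := IsFractionRing.lift hg
  have hι : Function.Injective ι := ι.injective
  have hιa : ∀ a, ι (algebraMap O (FractionRing O) a) = algebraMap R (FractionRing R) (j a) :=
    fun a => IsFractionRing.lift_algebraMap hg a
  have hιe : ι (algebraMap O (FractionRing O) x / algebraMap O (FractionRing O) y) =
      algebraMap R (FractionRing R) l := by
    have hy' : algebraMap R (FractionRing R) (j y) ≠ 0 := by
      rw [Ne, map_eq_zero_iff _ hR, map_eq_zero_iff _ hj]
      exact hy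
    rw [map_div₀, hιa, hιa, div_eq_iff hy', ← hxy, map_mul, mul_comm]
  refine ⟨algebraMap O (FractionRing O) x / algebraMap O (FractionRing O) y, ?_, ?_, ?_⟩
  · refine ⟨Polynomial.X ^ 2 - Polynomial.C t * Polynomial.X + Polynomial.C d, ?_, ?_⟩
    · monicity!
    · apply hι
      simp only [Polynomial.eval₂_add, Polynomial.eval₂_sub, Polynomial.eval₂_mul,
        Polynomial.eval₂_pow, Polynomial.eval₂_X, Polynomial.eval₂_C, map_add, map_sub, map_mul,
        map_pow, hιe, hιa, map_zero]
      rw [← map_pow, ← map_mul, ← map_sub, ← map_add, hl, map_zero]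
  · intro z hz
    have hz' : IsIntegral R (ι z) := by
      refine IsIntegral.map_of_comp_eq j ι ?_ hz
      ext a
      simp [hιa]
    obtain ⟨r, hr⟩ := IsIntegrallyClosed.isIntegral_iff.mp hz'
    obtain ⟨p, q, hq, hpq⟩ := IsFractionRing.div_surjective (A := O) z
    have hq0 : q ≠ 0 := nonZeroDivisors.ne_zero hq
    have hq' : algebraMap R (FractionRing R) (j q) ≠ 0 := by
      rw [Ne, map_eq_zero_iff _ hR, map_eq_zero_iff _ hj]
      exact hq0
    obtain ⟨a, b, hab⟩ := hB r p q hq0 (by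
      apply hR
      rw [map_mul, hr, ← hpq, map_div₀, hιa, hιa, div_mul_cancel₀ _ hq'])
    refine ⟨a, b, hι ?_⟩
    rw [← hr, hab, map_add, map_mul, map_add, map_mul, hιa, hιa, hιe,
      mul_comm (algebraMap R _ l)]
  · intro a b
    rw [← map_eq_zero_iff _ hι, map_add, map_mul, hιa, hιa, hιe, ← map_mul, ← map_add,
      map_eq_zero_iff _ hR, mul_comm l]

/-- The variables of the polynomial ring parametrizing the Kalman variety `K_{1,2,n}`. -/
inductive KalmanVar (n : ℕ)
  | row (i : Fin n)
  | col (j : Fin 2)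
  | free (i j : Fin n) (h : 2 ≤ (j : ℕ))
  | eig

/-- The polynomial ring parametrizing the Kalman variety `K_{1,2,n}`. -/
abbrev KalmanParamRing (K : Type*) [Field K] (n : ℕ) := MvPolynomial (KalmanVar n) K

namespace KalmanVar

open MvPolynomial

/-- The generic matrix whose first two columns are a rank one matrix plus a scalar. -/
noncomputable def entry (K : Type*) [Field K] (n : ℕ) (p : Fin n × Fin n) : KalmanParamRing K n :=
  if h : (p.2 : ℕ) < 2 then
    X (row p.1) * X (col ⟨p.2, h⟩) + if p.1 = p.2 then X eig else 0
  else X (free p.1 p.2 (not_lt.mp h))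

/-- The comorphism of the parametrization of `K_{1,2,n}`. -/
noncomputable def comorphism (K : Type*) [Field K] (n : ℕ) :
    MatCoordRing K n →ₐ[K] KalmanParamRing K n :=
  aeval (entry K n)

/-- The parametrization of `K_{1,2,n}`. -/
def point {K : Type*} [Field K] {n : ℕ} (x : KalmanVar n → K) : Matrix (Fin n) (Fin n) K :=
  fun i j => if h : (j : ℕ) < 2 then x (row i) * x (col ⟨j, h⟩) + if i = j then x eig else 0
    else x (free i j (not_lt.mp h))

theorem eval_comorphism {K : Type*} [Field K] {n : ℕ} (x : KalmanVar n → K)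
    (f : MatCoordRing K n) :
    eval x (comorphism K n f) = eval (fun p => point x p.1 p.2) f := by
  have h : ((aeval x : KalmanParamRing K n →ₐ[K] K).comp (comorphism K n)) =
      (aeval (fun p : Fin n × Fin n => point x p.1 p.2) : MatCoordRing K n →ₐ[K] K) := by
    ext p
    simp only [comorphism, entry, point, AlgHom.comp_apply, aeval_X]
    split_ifs <;> simp
  have := DFunLike.congr_fun h f
  simpa [aeval_eq_eval] using this

theorem exists_point_eq {K : Type*} [Field K] {n : ℕ} (hn : 3 ≤ n) (M : Matrix (Fin n) (Fin n) K)
    (l p q : K) (hpq : p ≠ 0 ∨ q ≠ 0)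
    (h : ∀ i : Fin n, M i ⟨0, by omega⟩ * p + M i ⟨1, by omega⟩ * q =
      l * ((if (i : ℕ) = 0 then p else 0) + if (i : ℕ) = 1 then q else 0)) :
    ∃ x : KalmanVar n → K, x eig = l ∧ point x = M := by
  rcases eq_or_ne p 0 with hp | hp
  · have hq : q ≠ 0 := by simpa [hp] using hpq
    refine ⟨fun s => match s with
      | row i => M i ⟨0, by omega⟩ - if (i : ℕ) = 0 then l else 0
      | col j => if j = 0 then 1 else -(p / q)
      | free i j _ => M i j
      | eig => l, rfl, ?_⟩
    ext i j
    rcases j with ⟨j, hj⟩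
    have hi := h i
    subst hp
    rcases j with _ | _ | j
    · simp [point, Fin.ext_iff]
    · simp only [mul_zero, zero_add, ite_self] at hi
      have : M i ⟨1, hj⟩ = l * if (i : ℕ) = 1 then 1 else 0 := by
        apply mul_right_cancel₀ hq
        rw [hi]
        split_ifs <;> ring
      simp only [point, Fin.ext_iff]
      rw [this]
      simp
    · simp [point]
  · refine ⟨fun s => match s with
      | row i => M i ⟨1, by omega⟩ - if (i : ℕ) = 1 then l else 0
      | col j => if j = 0 then -(q / p) else 1
      | free i j _ => M i j
      | eig => l, rfl, ?_⟩
    ext i j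
    rcases j with ⟨j, hj⟩
    have hi := h i
    rcases j with _ | _ | j
    · have : M i ⟨0, hj⟩ = l * ((if (i : ℕ) = 0 then 1 else 0) + if (i : ℕ) = 1 then q / p else 0)
          - M i ⟨1, by omega⟩ * (q / p) := by
        apply mul_right_cancel₀ hp
        rw [sub_mul, mul_assoc _ (q / p), div_mul_cancel₀ _ hp, eq_sub_iff_add_eq, hi, mul_assoc,
          add_mul, ite_mul, ite_mul, div_mul_cancel₀ _ hp, one_mul, zero_mul]
      simp only [point, Fin.ext_iff]
      rw [this]
      rcases eq_or_ne (i : ℕ) 0 with h0 | h0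
      · simp [h0]
        ring
      · rcases eq_or_ne (i : ℕ) 1 with h1 | h1
        · simp [h1]
          ring
        · simp [h0, h1]
    · simp [point, Fin.ext_iff]
    · simp [point]

end KalmanVar

theorem mulVec_apply_of_mem_firstCoordsSubspace {K : Type*} [Field K] {n : ℕ} (hn : 2 ≤ n)
    (M : Matrix (Fin n) (Fin n) K) {v : Fin n → K} (hv : v ∈ firstCoordsSubspace K n 2)
    (i : Fin n) :
    M.mulVec v i = M i ⟨0, by omega⟩ * v ⟨0, by omega⟩ + M i ⟨1, by omega⟩ * v ⟨1, by omega⟩ := by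
  refine Fintype.sum_eq_add (⟨0, by omega⟩ : Fin n) ⟨1, by omega⟩ (by simp) fun j hj => ?_
  have : 2 ≤ (j : ℕ) := by
    simp only [ne_eq, Fin.ext_iff] at hj
    omega
  rw [hv j this, mul_zero]

/-- The vector `(p, q, 0, …, 0)`. -/
def planeVec {K : Type*} [Field K] {n : ℕ} (p q : K) (i : Fin n) : K :=
  (if (i : ℕ) = 0 then p else 0) + if (i : ℕ) = 1 then q else 0

theorem planeVec_mem {K : Type*} [Field K] {n : ℕ} (p q : K) :
    (planeVec p q : Fin n → K) ∈ firstCoordsSubspace K n 2 := fun i hi => by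
  simp [planeVec, show (i : ℕ) ≠ 0 by omega, show (i : ℕ) ≠ 1 by omega]

theorem eq_planeVec {K : Type*} [Field K] {n : ℕ} (hn : 2 ≤ n) {v : Fin n → K}
    (hv : v ∈ firstCoordsSubspace K n 2) :
    v = planeVec (v ⟨0, by omega⟩) (v ⟨1, by omega⟩) := by
  ext ⟨i, hi⟩
  rcases i with _ | _ | i
  · simp [planeVec]
  · simp [planeVec]
  · simpa [planeVec] using hv ⟨i + 2, hi⟩ (by simp)

theorem finrank_firstCoordsSubspace_two (K : Type*) [Field K] {n : ℕ} (hn : 2 ≤ n) :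
    Module.finrank K (firstCoordsSubspace K n 2) = 2 := by
  let e : (Fin 2 → K) ≃ₗ[K] firstCoordsSubspace K n 2 :=
    { toFun := fun w => ⟨planeVec (w 0) (w 1), planeVec_mem _ _⟩
      map_add' := fun a b => by
        ext i
        simp only [planeVec, Pi.add_apply, Submodule.coe_add]
        split_ifs <;> ring
      map_smul' := fun c a => by
        ext i
        simp [planeVec, mul_add]
      invFun := fun v => ![v.1 ⟨0, by omega⟩, v.1 ⟨1, by omega⟩]
      left_inv := fun w => by
        ext i
        fin_cases i <;> simp [planeVec]
      right_inv := fun v => Subtype.ext (eq_planeVec hn v.2).symm }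
  rw [← e.finrank_eq, Module.finrank_fin_fun]

theorem planeVec_ne_zero_iff {K : Type*} [Field K] {n : ℕ} (hn : 2 ≤ n) {p q : K} :
    (planeVec p q : Fin n → K) ≠ 0 ↔ p ≠ 0 ∨ q ≠ 0 := by
  rw [← not_and_or, not_iff_not]
  constructor
  · intro h
    have h0 := congrFun h ⟨0, by omega⟩
    have h1 := congrFun h ⟨1, by omega⟩
    simpa [planeVec] using And.intro h0 h1
  · rintro ⟨rfl, rfl⟩
    ext i
    simp [planeVec]

theorem mulVec_planeVec {K : Type*} [Field K] {n : ℕ} (hn : 2 ≤ n)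
    (M : Matrix (Fin n) (Fin n) K) (p q : K) (i : Fin n) :
    M.mulVec (planeVec p q) i = M i ⟨0, by omega⟩ * p + M i ⟨1, by omega⟩ * q := by
  rw [mulVec_apply_of_mem_firstCoordsSubspace hn M (planeVec_mem p q)]
  simp [planeVec]

namespace KalmanVar

open MvPolynomial

theorem exists_point_eq_of_mem {K : Type*} [Field K] {n : ℕ} (hn : 3 ≤ n)
    {M : Matrix (Fin n) (Fin n) K} (hM : M ∈ kalmanSet K n 2 1) :
    ∃ x : KalmanVar n → K, point x = M := by
  obtain ⟨U, hUL, hU, hinv⟩ := hM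
  obtain ⟨⟨v, hvU⟩, hv0, hv⟩ := finrank_eq_one_iff'.mp hU
  obtain ⟨c, hc⟩ := hv ⟨M.mulVec v, hinv v hvU⟩
  have hc' : c • v = M.mulVec v := congrArg Subtype.val hc
  have hvp := eq_planeVec (by omega) (hUL hvU)
  have hv0' : v ≠ 0 := fun h => hv0 (Subtype.ext h)
  rw [hvp] at hc' hv0'
  obtain ⟨x, -, hx⟩ := exists_point_eq hn M c _ _ ((planeVec_ne_zero_iff (by omega)).mp hv0')
    (fun i => by
      rw [← mulVec_planeVec (by omega) M, ← hc']
      rfl)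
  exact ⟨x, hx⟩

theorem mem_of_mulVec_planeVec {K : Type*} [Field K] {n : ℕ} (hn : 2 ≤ n)
    {M : Matrix (Fin n) (Fin n) K} {p q l : K} (hpq : p ≠ 0 ∨ q ≠ 0)
    (h : M.mulVec (planeVec p q) = l • planeVec p q) : M ∈ kalmanSet K n 2 1 := by
  refine ⟨K ∙ (planeVec p q), ?_, finrank_span_singleton ((planeVec_ne_zero_iff hn).mpr hpq), ?_⟩
  · rw [Submodule.span_singleton_le_iff_mem]
    exact planeVec_mem p q
  · intro v hv
    obtain ⟨c, rfl⟩ := Submodule.mem_span_singleton.mp hv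
    rw [Matrix.mulVec_smul, h]
    exact Submodule.smul_mem _ _ (Submodule.smul_mem _ _ (Submodule.mem_span_singleton_self _))

theorem point_mem {K : Type*} [Field K] {n : ℕ} (hn : 3 ≤ n) (x : KalmanVar n → K) :
    point x ∈ kalmanSet K n 2 1 := by
  have key : ∀ p q : K, x (col 0) * p + x (col 1) * q = 0 →
      (point x).mulVec (planeVec p q) = x eig • planeVec p q := by
    intro p q h
    ext i
    rw [mulVec_planeVec (by omega)]
    simp only [point, Fin.ext_iff, planeVec, Pi.smul_apply, smul_eq_mul]
    have : x (row i) * (x (col 0) * p + x (col 1) * q) = 0 := by rw [h, mul_zero]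
    simp
    split_ifs <;> linear_combination this
  by_cases h : x (col 1) ≠ 0 ∨ -x (col 0) ≠ 0
  · exact mem_of_mulVec_planeVec (by omega) h (key _ _ (by ring))
  · push Not at h
    refine mem_of_mulVec_planeVec (p := 1) (q := 0) (by omega) (Or.inl one_ne_zero) (key _ _ ?_)
    simpa using h.2

theorem comorphism_eq_zero_iff {K : Type*} [Field K] [Infinite K] {n : ℕ} (hn : 3 ≤ n)
    (f : MatCoordRing K n) : comorphism K n f = 0 ↔ f ∈ kalmanIdeal K n 2 1 := by
  constructor
  · intro h M hM
    obtain ⟨x, rfl⟩ := exists_point_eq_of_mem hn hM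
    rw [← eval_comorphism, h, map_zero]
  · intro h
    refine MvPolynomial.funext fun x => ?_
    rw [eval_comorphism, map_zero]
    exact h _ (point_mem hn x)

/-- The matrix with its lower-left block replaced by zero. -/
def truncate {K : Type*} [Field K] {n : ℕ} (M : Matrix (Fin n) (Fin n) K) :
    Matrix (Fin n) (Fin n) K :=
  fun i j => if 2 ≤ (i : ℕ) ∧ (j : ℕ) < 2 then 0 else M i j

/-- The substitution of zero for the entries of the lower-left block. -/
noncomputable def truncateHom (K : Type*) [Field K] (n : ℕ) :
    MatCoordRing K n →ₐ[K] MatCoordRing K n :=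
  aeval fun p => if 2 ≤ (p.1 : ℕ) ∧ (p.2 : ℕ) < 2 then 0 else X p

theorem eval_truncateHom {K : Type*} [Field K] {n : ℕ} (M : Matrix (Fin n) (Fin n) K)
    (f : MatCoordRing K n) :
    eval (fun p => M p.1 p.2) (truncateHom K n f) = eval (fun p => truncate M p.1 p.2) f := by
  have h : ((aeval (fun p : Fin n × Fin n => M p.1 p.2) : MatCoordRing K n →ₐ[K] K).comp
      (truncateHom K n)) =
      (aeval (fun p : Fin n × Fin n => truncate M p.1 p.2) : MatCoordRing K n →ₐ[K] K) := by
    ext p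
    simp only [truncateHom, truncate, AlgHom.comp_apply, aeval_X]
    split_ifs <;> simp
  have := DFunLike.congr_fun h f
  simpa [aeval_eq_eval] using this

theorem truncate_mem {K : Type*} [Field K] {n : ℕ} (hn : 2 ≤ n) (M : Matrix (Fin n) (Fin n) K) :
    truncate M ∈ kalmanSet K n 2 2 := by
  refine ⟨_, le_rfl, finrank_firstCoordsSubspace_two K hn, fun v hv i hi => ?_⟩
  rw [mulVec_apply_of_mem_firstCoordsSubspace hn _ hv]
  simp [truncate, hi]

theorem truncate_eq_of_mem {K : Type*} [Field K] {n : ℕ} (hn : 2 ≤ n)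
    {M : Matrix (Fin n) (Fin n) K} (hM : M ∈ kalmanSet K n 2 2) : truncate M = M := by
  obtain ⟨U, hUL, hU, hinv⟩ := hM
  obtain rfl := Submodule.eq_of_le_of_finrank_eq hUL
    (hU.trans (finrank_firstCoordsSubspace_two K hn).symm)
  ext i ⟨j, hj⟩
  by_cases h : 2 ≤ (i : ℕ) ∧ j < 2
  · have h0 := hinv _ (planeVec_mem 1 0) i h.1
    have h1 := hinv _ (planeVec_mem 0 1) i h.1
    rw [mulVec_planeVec hn] at h0 h1
    rcases j with _ | _ | j
    · simpa [truncate, h.1] using h0.symm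
    · simpa [truncate, h.1] using h1.symm
    · omega
  · exact if_neg h

theorem truncateHom_eq_zero_iff {K : Type*} [Field K] [Infinite K] {n : ℕ} (hn : 2 ≤ n)
    (f : MatCoordRing K n) : truncateHom K n f = 0 ↔ f ∈ kalmanIdeal K n 2 2 := by
  constructor
  · intro h M hM
    rw [← truncate_eq_of_mem hn hM, ← eval_truncateHom, h, map_zero]
  · intro h
    refine MvPolynomial.funext fun x => ?_
    have := eval_truncateHom (fun i j => x (i, j)) f
    rw [map_zero]
    exact this.trans (h _ (truncate_mem hn _))

end KalmanVar

theorem LinearMap.exists_factor_of_ker_le {R M N P : Type*} [CommRing R] [AddCommGroup M]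
    [CommRing N] [AddCommGroup P] [Module R M] [Algebra R N] [Module R P] (f : M →ₗ[R] N)
    (hf : Function.Surjective f) (h : M →ₗ[R] P) (hker : LinearMap.ker f ≤ LinearMap.ker h) :
    ∃ g : N →ₗ[R] P, ∀ x, g (f x) = h x := by
  refine ⟨((LinearMap.ker f).liftQ h hker).comp
    (f.quotKerEquivOfSurjective hf).symm.toLinearMap, fun x => ?_⟩
  have : (f.quotKerEquivOfSurjective hf).symm (f x) = Submodule.Quotient.mk x := by
    rw [LinearEquiv.symm_apply_eq]
    rfl
  rw [LinearMap.comp_apply, LinearEquiv.coe_coe, this]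
  rfl

namespace KalmanVar

open MvPolynomial

theorem comorphism_X (K : Type*) [Field K] {n : ℕ} (p : Fin n × Fin n) :
    comorphism K n (X p) = entry K n p := by
  simp [comorphism]

theorem comorphism_X_zero (K : Type*) [Field K] {n : ℕ} (h : 0 < n) (i : Fin n) :
    comorphism K n (X (i, ⟨0, h⟩)) =
      X (row i) * X (col 0) + if (i : ℕ) = 0 then X eig else 0 := by
  simp [comorphism_X, entry, Fin.ext_iff]

theorem comorphism_X_one (K : Type*) [Field K] {n : ℕ} (h : 1 < n) (i : Fin n) :
    comorphism K n (X (i, ⟨1, h⟩)) =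
      X (row i) * X (col 1) + if (i : ℕ) = 1 then X eig else 0 := by
  simp [comorphism_X, entry, Fin.ext_iff]

/-- The trace of the upper-left `2 × 2` block. -/
noncomputable def blockTrace (K : Type*) [Field K] {n : ℕ} (hn : 2 ≤ n) : MatCoordRing K n :=
  X (⟨0, by omega⟩, ⟨0, by omega⟩) + X (⟨1, by omega⟩, ⟨1, by omega⟩)

/-- The determinant of the upper-left `2 × 2` block. -/
noncomputable def blockDet (K : Type*) [Field K] {n : ℕ} (hn : 2 ≤ n) : MatCoordRing K n :=
  X (⟨0, by omega⟩, ⟨0, by omega⟩) * X (⟨1, by omega⟩, ⟨1, by omega⟩) -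
    X (⟨0, by omega⟩, ⟨1, by omega⟩) * X (⟨1, by omega⟩, ⟨0, by omega⟩)

theorem eig_sq (K : Type*) [Field K] {n : ℕ} (hn : 2 ≤ n) :
    X eig ^ 2 - comorphism K n (blockTrace K hn) * X eig + comorphism K n (blockDet K hn) = 0 := by
  simp only [blockTrace, blockDet, map_add, map_sub, map_mul, comorphism_X_zero, comorphism_X_one]
  simp
  ring

/-- The subalgebra generated by the coordinate ring of `K_{1,2,n}` and the eigenvalue. -/
noncomputable def eigSubalgebra (K : Type*) [Field K] {n : ℕ} (hn : 2 ≤ n) :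
    Subalgebra K (KalmanParamRing K n) where
  carrier := {r | ∃ a b, r = comorphism K n a + X eig * comorphism K n b}
  add_mem' := by
    rintro _ _ ⟨a, b, rfl⟩ ⟨a', b', rfl⟩
    exact ⟨a + a', b + b', by simp only [map_add]; ring⟩
  mul_mem' := by
    rintro _ _ ⟨a, b, rfl⟩ ⟨a', b', rfl⟩
    refine ⟨a * a' - blockDet K hn * (b * b'), a * b' + b * a' + blockTrace K hn * (b * b'), ?_⟩
    simp only [map_add, map_sub, map_mul]
    linear_combination (comorphism K n b * comorphism K n b') * eig_sq K hn
  algebraMap_mem' := fun c => ⟨algebraMap K _ c, 0, by simp⟩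

theorem comorphism_mem_eigSubalgebra {K : Type*} [Field K] {n : ℕ} (hn : 2 ≤ n)
    (a : MatCoordRing K n) : comorphism K n a ∈ eigSubalgebra K hn :=
  ⟨a, 0, by simp⟩

theorem eig_mem_eigSubalgebra (K : Type*) [Field K] {n : ℕ} (hn : 2 ≤ n) :
    X eig ∈ eigSubalgebra K hn :=
  ⟨0, 1, by simp⟩

theorem row_mul_col_mem_eigSubalgebra (K : Type*) [Field K] {n : ℕ} (hn : 2 ≤ n) (i : Fin n)
    (j : Fin 2) : X (row i) * X (col j) ∈ eigSubalgebra K hn := by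
  have h : X (row i) * X (col j) = comorphism K n (X (i, Fin.castLE hn j)) -
      if i = Fin.castLE hn j then X eig else 0 := by
    rw [comorphism_X, entry, dif_pos (show ((Fin.castLE hn j : Fin n) : ℕ) < 2 from j.2)]
    simp
  rw [h]
  refine sub_mem (comorphism_mem_eigSubalgebra hn _) ?_
  split_ifs
  · exact eig_mem_eigSubalgebra K hn
  · exact zero_mem _

theorem free_mem_eigSubalgebra (K : Type*) [Field K] {n : ℕ} (hn : 2 ≤ n) (i j : Fin n)
    (h : 2 ≤ (j : ℕ)) : X (free i j h) ∈ eigSubalgebra K hn := by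
  have : X (free i j h) = comorphism K n (X (i, j)) := by
    rw [comorphism_X, entry, dif_neg (not_lt.mpr h)]
  rw [this]
  exact comorphism_mem_eigSubalgebra hn _

/-- The torus weights for which the entries of the generic matrix are invariant. -/
def torusWeight {n : ℕ} : KalmanVar n → ℤ
  | row _ => 1
  | col _ => -1
  | free _ _ _ => 0
  | eig => 0

theorem monomial_mem_eigSubalgebra {K : Type*} [Field K] {n : ℕ} (hn : 2 ≤ n)
    (m : KalmanVar n →₀ ℕ) (hm : Finsupp.weight torusWeight m = 0) :
    monomial m (1 : K) ∈ eigSubalgebra K hn := by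
  classical
  induction hd : m.degree using Nat.strong_induction_on generalizing m with
  | _ d ih =>
  have hone : ∀ s : KalmanVar n, m s ≠ 0 → ∃ m', m = Finsupp.single s 1 + m' := fun s hs =>
    ⟨m - Finsupp.single s 1, (add_tsub_cancel_of_le (by
      rw [Finsupp.single_le_iff]; omega)).symm⟩
  have hinv : ∀ s : KalmanVar n, torusWeight s = 0 → X s ∈ eigSubalgebra K hn → m s ≠ 0 →
      monomial m (1 : K) ∈ eigSubalgebra K hn := by
    intro s hs hX hms
    obtain ⟨m', rfl⟩ := hone s hms
    rw [map_add, Finsupp.weight_single, hs, smul_zero, zero_add] at hm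
    have : monomial (Finsupp.single s 1 + m') (1 : K) = X s * monomial m' 1 := by
      rw [X, monomial_mul, one_mul]
    rw [this]
    exact mul_mem hX (ih _ (by rw [← hd, map_add]; simp) m' hm rfl)
  have hpair : ∀ i j, m (row i) ≠ 0 → m (col j) ≠ 0 →
      monomial m (1 : K) ∈ eigSubalgebra K hn := by
    intro i j hi hj
    obtain ⟨m', rfl⟩ := hone _ hi
    have hj' : m' (col j) ≠ 0 := by simpa using hj
    obtain ⟨m'', rfl⟩ : ∃ m'', m' = Finsupp.single (col j) 1 + m'' :=
      ⟨m' - Finsupp.single (col j) 1, (add_tsub_cancel_of_le (by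
        rw [Finsupp.single_le_iff]; omega)).symm⟩
    rw [map_add, map_add, Finsupp.weight_single, Finsupp.weight_single] at hm
    have : monomial (Finsupp.single (row i) 1 + (Finsupp.single (col j) 1 + m'')) (1 : K) =
        X (row i) * X (col j) * monomial m'' 1 := by
      rw [X, X, monomial_mul, monomial_mul, add_assoc, one_mul, one_mul]
    rw [this]
    refine mul_mem (row_mul_col_mem_eigSubalgebra K hn i j)
      (ih _ (by rw [← hd, map_add, map_add]; simp; omega) m'' ?_ rfl)
    simpa [torusWeight] using hm
  by_cases heig : m eig = 0
  swap
  · exact hinv eig rfl (eig_mem_eigSubalgebra K hn) heig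
  by_cases hfree : ∃ i j h, m (free i j h) ≠ 0
  · obtain ⟨i, j, h, hijh⟩ := hfree
    exact hinv _ rfl (free_mem_eigSubalgebra K hn i j h) hijh
  by_cases hrow : ∃ i, m (row i) ≠ 0
  · obtain ⟨i, hi⟩ := hrow
    by_cases hcol : ∃ j, m (col j) ≠ 0
    · obtain ⟨j, hj⟩ := hcol
      exact hpair i j hi hj
    · push Not at hcol
      exfalso
      rw [Finsupp.weight_apply, Finsupp.sum, Finset.sum_eq_zero_iff_of_nonneg] at hm
      · have := hm (row i) (by simpa using hi)
        simp [torusWeight] at this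
        omega
      · rintro (i | j | _ | _) hs <;> simp [torusWeight, hcol]
  by_cases hcol : ∃ j, m (col j) ≠ 0
  · obtain ⟨j, hj⟩ := hcol
    push Not at hrow
    exfalso
    rw [Finsupp.weight_apply, Finsupp.sum, Finset.sum_eq_zero_iff_of_nonpos] at hm
    · have := hm (col j) (by simpa using hj)
      simp [torusWeight] at this
      omega
    · rintro (i | j | _ | _) hs <;> simp [torusWeight, hrow]
  have : m = 0 := by
    push Not at hfree hrow hcol
    ext (i | j | _ | _) <;> simp [*]
  rw [this]
  exact one_mem _

theorem mem_eigSubalgebra_of_isWeightedHomogeneous {K : Type*} [Field K] {n : ℕ} (hn : 2 ≤ n)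
    {r : KalmanParamRing K n} (hr : IsWeightedHomogeneous torusWeight r 0) :
    r ∈ eigSubalgebra K hn := by
  rw [r.as_sum]
  refine sum_mem fun m hm => ?_
  have : monomial m (coeff m r) = coeff m r • monomial m (1 : K) := by
    rw [smul_monomial, smul_eq_mul, mul_one]
  rw [this]
  exact Subalgebra.smul_mem _ (monomial_mem_eigSubalgebra hn m (hr (mem_support_iff.mp hm))) _

theorem isWeightedHomogeneous_comorphism {K : Type*} [Field K] {n : ℕ} (a : MatCoordRing K n) :
    IsWeightedHomogeneous torusWeight (comorphism K n a) 0 := by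
  have hX : ∀ s : KalmanVar n, IsWeightedHomogeneous torusWeight (X s : KalmanParamRing K n)
    (torusWeight s) := isWeightedHomogeneous_X K torusWeight
  induction a using MvPolynomial.induction_on with
  | C c =>
    rw [← algebraMap_eq, AlgHom.commutes, algebraMap_eq]
    exact isWeightedHomogeneous_C _ _
  | add p q hp hq =>
    rw [map_add]
    exact hp.add hq
  | mul_X p s hp =>
    rw [map_mul, comorphism_X, ← add_zero (0 : ℤ)]
    refine hp.mul ?_
    rw [entry]
    split_ifs
    · exact ((hX (row _)).mul (hX (col _))).add (hX eig)
    · rw [add_zero]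
      exact (hX (row _)).mul (hX (col _))
    · exact hX (free _ _ _)

theorem mem_eigSubalgebra_of_mul_comorphism_eq {K : Type*} [Field K] {n : ℕ} (hn : 2 ≤ n)
    {r : KalmanParamRing K n} {p q : MatCoordRing K n} (hq : comorphism K n q ≠ 0)
    (h : r * comorphism K n q = comorphism K n p) : r ∈ eigSubalgebra K hn := by
  classical
  let G := weightedHomogeneousSubmodule K (torusWeight (n := n))
  let _ : GradedAlgebra G := weightedGradedAlgebra K torusWeight
  have hq' : comorphism K n q ∈ G 0 := isWeightedHomogeneous_comorphism q
  have hp' : comorphism K n p ∈ G 0 := isWeightedHomogeneous_comorphism p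
  have h1 := DirectSum.coe_decompose_mul_of_left_mem_zero G (j := 0) (b := r) hq'
  rw [mul_comm, h, DirectSum.decompose_of_mem_same G hp', ← h, mul_comm] at h1
  have h2 := mul_left_cancel₀ hq h1
  refine mem_eigSubalgebra_of_isWeightedHomogeneous hn ?_
  rw [h2]
  exact (DirectSum.decompose G r 0).2

theorem exists_eig_mul_row_mul_col (K : Type*) [Field K] {n : ℕ} (hn : 2 ≤ n) {i j : Fin n}
    (hi : 2 ≤ (i : ℕ)) (hj : (j : ℕ) < 2) :
    ∃ c, X eig * comorphism K n (X (i, j)) = comorphism K n c := by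
  have hi0 : (i : ℕ) ≠ 0 := by omega
  have hi1 : (i : ℕ) ≠ 1 := by omega
  obtain ⟨j, hjn⟩ := j
  refine ⟨X (i, ⟨j, hjn⟩) * blockTrace K hn - X (i, ⟨0, by omega⟩) * X (⟨0, by omega⟩, ⟨j, hjn⟩)
    - X (i, ⟨1, by omega⟩) * X (⟨1, by omega⟩, ⟨j, hjn⟩), ?_⟩
  rcases j with _ | _ | j
  · simp only [blockTrace, map_add, map_sub, map_mul, comorphism_X_zero, comorphism_X_one, hi0, hi1]
    simp
    ring
  · simp only [zero_add, blockTrace, map_add, map_sub, map_mul, comorphism_X_zero, comorphism_X_one,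
      hi0, hi1]
    simp
    ring
  · simp at hj

/-- The ideal of functions multiplying the eigenvalue into the coordinate ring of `K_{1,2,n}`. -/
noncomputable def eigConductor (K : Type*) [Field K] (n : ℕ) : Ideal (MatCoordRing K n) where
  carrier := {b | ∃ c, X eig * comorphism K n b = comorphism K n c}
  add_mem' := by
    rintro a b ⟨c, hc⟩ ⟨d, hd⟩
    exact ⟨c + d, by rw [map_add, mul_add, hc, hd, map_add]⟩
  zero_mem' := ⟨0, by simp⟩
  smul_mem' := by
    rintro a b ⟨c, hc⟩
    exact ⟨a * c, by rw [smul_eq_mul, map_mul, map_mul, ← hc]; ring⟩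

theorem mem_eigConductor_of_truncateHom_eq_zero {K : Type*} [Field K] {n : ℕ} (hn : 2 ≤ n)
    {b : MatCoordRing K n} (hb : truncateHom K n b = 0) : b ∈ eigConductor K n := by
  have h : (Ideal.Quotient.mkₐ K (eigConductor K n)).comp (truncateHom K n) =
      Ideal.Quotient.mkₐ K (eigConductor K n) := by
    ext p
    simp only [truncateHom, AlgHom.comp_apply, aeval_X]
    split_ifs with hp
    · rw [map_zero, eq_comm]
      exact Ideal.Quotient.eq_zero_iff_mem.mpr (exists_eig_mul_row_mul_col K hn hp.1 hp.2)
    · rfl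
  have h2 := DFunLike.congr_fun h b
  rw [AlgHom.comp_apply, hb, map_zero, eq_comm] at h2
  exact Ideal.Quotient.eq_zero_iff_mem.mp h2

theorem eval_truncate_add_eq_zero {K : Type*} [Field K] {n : ℕ} (hn : 3 ≤ n)
    {a b : MatCoordRing K n} (h : comorphism K n a + X eig * comorphism K n b = 0)
    (M : Matrix (Fin n) (Fin n) K) (l : K)
    (hl : l ^ 2 - eval (fun p => truncate M p.1 p.2) (blockTrace K (by omega)) * l +
      eval (fun p => truncate M p.1 p.2) (blockDet K (by omega)) = 0) :
    eval (fun p => truncate M p.1 p.2) a + l * eval (fun p => truncate M p.1 p.2) b = 0 := by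
  obtain ⟨p, q, hpq, h0, h1⟩ : ∃ p q : K, (p ≠ 0 ∨ q ≠ 0) ∧
      (M ⟨0, by omega⟩ ⟨0, by omega⟩ - l) * p + M ⟨0, by omega⟩ ⟨1, by omega⟩ * q = 0 ∧
      M ⟨1, by omega⟩ ⟨0, by omega⟩ * p + (M ⟨1, by omega⟩ ⟨1, by omega⟩ - l) * q = 0 := by
    have hdet : (M ⟨0, by omega⟩ ⟨0, by omega⟩ - l) * (M ⟨1, by omega⟩ ⟨1, by omega⟩ - l) -
        M ⟨0, by omega⟩ ⟨1, by omega⟩ * M ⟨1, by omega⟩ ⟨0, by omega⟩ = 0 := by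
      simp [blockTrace, blockDet, truncate] at hl
      linear_combination hl
    obtain ⟨v, hv, hMv⟩ := Matrix.exists_mulVec_eq_zero_iff.mpr
      ((Matrix.det_fin_two_of (M ⟨0, by omega⟩ ⟨0, by omega⟩ - l) (M ⟨0, by omega⟩ ⟨1, by omega⟩)
        (M ⟨1, by omega⟩ ⟨0, by omega⟩) (M ⟨1, by omega⟩ ⟨1, by omega⟩ - l)).trans hdet)
    refine ⟨v 0, v 1, ?_, ?_, ?_⟩
    · by_contra! hcon
      apply hv
      ext i
      fin_cases i <;> simp [hcon]
    · simpa [Matrix.mulVec, dotProduct] using congrFun hMv 0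
    · simpa [Matrix.mulVec, dotProduct] using congrFun hMv 1
  obtain ⟨x, hx, hxM⟩ := exists_point_eq hn (truncate M) l p q hpq (by
    rintro ⟨i, hi⟩
    rcases i with _ | _ | i
    · simp [truncate]
      linear_combination h0
    · simp [truncate]
      linear_combination h1
    · simp [truncate])
  have := congrArg (eval x) h
  rwa [map_add, map_mul, eval_comorphism, eval_comorphism, eval_X, map_zero, hx, hxM] at this

theorem truncateHom_eq_zero_of_comorphism {K : Type*} [Field K] [IsAlgClosed K] {n : ℕ}
    (hn : 3 ≤ n) {a b : MatCoordRing K n}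
    (h : comorphism K n a + X eig * comorphism K n b = 0) : truncateHom K n b = 0 := by
  have hn2 : 2 ≤ n := by omega
  have : Infinite K := IsAlgClosed.instInfinite
  have hzero : truncateHom K n ((blockTrace K hn2 ^ 2 - 4 * blockDet K hn2) * b) = 0 := by
    refine MvPolynomial.funext fun x => ?_
    rw [map_zero]
    refine (eval_truncateHom (fun i j => x (i, j)) _).trans ?_
    set f := eval (fun p : Fin n × Fin n => truncate (fun i j => x (i, j)) p.1 p.2) with hf
    obtain ⟨l, hl⟩ := IsAlgClosed.exists_root
      (Polynomial.C (1 : K) * Polynomial.X ^ 2 + Polynomial.C (-f (blockTrace K hn2)) * Polynomial.X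
        + Polynomial.C (f (blockDet K hn2)))
      (by rw [Polynomial.degree_quadratic one_ne_zero]; decide)
    have hl' : l ^ 2 - f (blockTrace K hn2) * l + f (blockDet K hn2) = 0 := by
      simp [Polynomial.IsRoot] at hl
      linear_combination hl
    have h1 := eval_truncate_add_eq_zero hn h _ l hl'
    have h2 := eval_truncate_add_eq_zero hn h (fun i j => x (i, j)) (f (blockTrace K hn2) - l)
      (by rw [← hf]; linear_combination hl')
    rw [← hf] at h1 h2
    simp only [map_mul, map_sub, map_pow, map_ofNat]
    linear_combination (2 * l - f (blockTrace K hn2)) * (h1 - h2) - 4 * f b * hl'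
  rw [map_mul] at hzero
  refine (mul_eq_zero.mp hzero).resolve_left fun h0 => ?_
  have := eval_truncateHom (fun i j : Fin n => if (i : ℕ) = 0 ∧ (j : ℕ) = 0 then (1 : K) else 0)
    (blockTrace K hn2 ^ 2 - 4 * blockDet K hn2)
  rw [h0] at this
  simp [blockTrace, blockDet, truncate] at this

end KalmanVar

theorem stmt5 (K : Type*) [Field K] [IsAlgClosed K] (n : ℕ) (hn : 3 ≤ n) :
    ∃ g : KalmanNormalization K n 2 1 →ₗ[MatCoordRing K n] KalmanCoordRing K n 2 2,
      Function.Injective (kalmanNormInclusion K n 2 1) ∧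
      LinearMap.ker g = LinearMap.range (kalmanNormInclusion K n 2 1) ∧
      Function.Surjective g := by
  open KalmanVar in
  have hn2 : 2 ≤ n := by omega
  have : Infinite K := IsAlgClosed.instInfinite
  let φ := comorphism K n
  have hI : kalmanIdeal K n 2 1 = RingHom.ker φ := by
    ext f
    exact (comorphism_eq_zero_iff hn f).symm
  have hprime : (kalmanIdeal K n 2 1).IsPrime := hI ▸ RingHom.ker_isPrime φ
  have hdom : IsDomain (KalmanCoordRing K n 2 1) := Ideal.Quotient.isDomain _
  let j : KalmanCoordRing K n 2 1 →+* KalmanParamRing K n :=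
    Ideal.Quotient.lift _ (φ : MatCoordRing K n →+* KalmanParamRing K n)
      fun a ha => (comorphism_eq_zero_iff hn a).mpr ha
  have hjmk : ∀ a, j (Ideal.Quotient.mk _ a) = φ a := fun a => Ideal.Quotient.lift_mk _ _ _
  have hj : Function.Injective j := by
    rw [injective_iff_map_eq_zero]
    intro a ha
    obtain ⟨a, rfl⟩ := Ideal.Quotient.mk_surjective a
    rw [hjmk] at ha
    exact Ideal.Quotient.eq_zero_iff_mem.mpr ((comorphism_eq_zero_iff hn a).mp ha)
  obtain ⟨c, hc⟩ := exists_eig_mul_row_mul_col K hn2 (i := ⟨2, by omega⟩) (j := ⟨0, by omega⟩)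
    le_rfl (by simp)
  obtain ⟨e, he, hspan, hrel⟩ := exists_integralClosure_generator j hj (MvPolynomial.X eig)
    (Ideal.Quotient.mk _ c) (Ideal.Quotient.mk _ (MvPolynomial.X (⟨2, by omega⟩, ⟨0, by omega⟩)))
    (Ideal.Quotient.mk _ (blockTrace K hn2)) (Ideal.Quotient.mk _ (blockDet K hn2))
    (by
      rw [← map_ne_zero_iff j hj, hjmk]
      simp [φ, comorphism_X_zero])
    (by rw [hjmk, hjmk, mul_comm]; exact hc)
    (by rw [hjmk, hjmk]; exact eig_sq K hn2)
    (by
      intro r p q hq h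
      obtain ⟨p, rfl⟩ := Ideal.Quotient.mk_surjective p
      obtain ⟨q, rfl⟩ := Ideal.Quotient.mk_surjective q
      rw [← map_ne_zero_iff j hj, hjmk] at hq
      rw [hjmk, hjmk] at h
      obtain ⟨a, b, hab⟩ := mem_eigSubalgebra_of_mul_comorphism_eq hn2 hq h
      exact ⟨Ideal.Quotient.mk _ a, Ideal.Quotient.mk _ b, by rw [hjmk, hjmk]; exact hab⟩)
  let ι : KalmanNormalization K n 2 1 →+* FractionRing (KalmanCoordRing K n 2 1) :=
    (integralClosure (KalmanCoordRing K n 2 1)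
      (FractionRing (KalmanCoordRing K n 2 1))).val.toRingHom
  have hι : Function.Injective ι := Subtype.val_injective
  have hιa : ∀ a : MatCoordRing K n, ι (algebraMap _ _ a) =
      algebraMap (KalmanCoordRing K n 2 1) _ (Ideal.Quotient.mk _ a) := fun a => rfl
  let e' : KalmanNormalization K n 2 1 := ⟨e, he⟩
  have hιe : ι e' = e := rfl
  let f : MatCoordRing K n × MatCoordRing K n →ₗ[MatCoordRing K n] KalmanNormalization K n 2 1 :=
    (Algebra.linearMap _ _).coprod (LinearMap.toSpanSingleton _ _ e')
  have hf : ∀ a b, f (a, b) = algebraMap _ _ a + algebraMap _ _ b * e' := fun a b => by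
    simp [f, Algebra.smul_def]
  have hf0 : ∀ a b, f (a, b) = 0 ↔ φ a + MvPolynomial.X eig * φ b = 0 := fun a b => by
    rw [hf, ← map_eq_zero_iff ι hι, map_add, map_mul, hιa, hιa, hιe, hrel, hjmk, hjmk]
  have hfsurj : Function.Surjective f := fun z => by
    obtain ⟨a, b, hab⟩ := hspan (ι z) z.2
    obtain ⟨a, rfl⟩ := Ideal.Quotient.mk_surjective a
    obtain ⟨b, rfl⟩ := Ideal.Quotient.mk_surjective b
    refine ⟨(a, b), hι ?_⟩
    rw [hf, map_add, map_mul, hιa, hιa, hιe, hab]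
  let h : MatCoordRing K n × MatCoordRing K n →ₗ[MatCoordRing K n] KalmanCoordRing K n 2 2 :=
    (Algebra.linearMap _ _).comp (LinearMap.snd _ _ _)
  have hh : ∀ a b, h (a, b) = Ideal.Quotient.mk _ b := fun a b => rfl
  have hker : LinearMap.ker f ≤ LinearMap.ker h := by
    rintro ⟨a, b⟩ hab
    rw [LinearMap.mem_ker, hf0] at hab
    rw [LinearMap.mem_ker, hh, Ideal.Quotient.eq_zero_iff_mem, ← truncateHom_eq_zero_iff hn2]
    exact truncateHom_eq_zero_of_comorphism hn hab
  obtain ⟨g, hgf⟩ := f.exists_factor_of_ker_le hfsurj h hker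
  have hg : ∀ a b, g (f (a, b)) = Ideal.Quotient.mk _ b := fun a b => hgf (a, b)
  have hincl : ∀ a, kalmanNormInclusion K n 2 1 (Ideal.Quotient.mk _ a) = f (a, 0) := fun a => by
    rw [hf, map_zero, zero_mul, add_zero]
    rfl
  refine ⟨g, ?_, ?_, ?_⟩
  · intro a b hab
    exact IsFractionRing.injective (KalmanCoordRing K n 2 1)
      (FractionRing (KalmanCoordRing K n 2 1)) (congrArg ι hab)
  · ext z
    obtain ⟨⟨a, b⟩, rfl⟩ := hfsurj z
    rw [LinearMap.mem_ker, hg, LinearMap.mem_range]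
    constructor
    · intro hb
      rw [Ideal.Quotient.eq_zero_iff_mem, ← truncateHom_eq_zero_iff hn2] at hb
      obtain ⟨d, hd⟩ := mem_eigConductor_of_truncateHom_eq_zero hn2 hb
      refine ⟨Ideal.Quotient.mk _ (a + d), ?_⟩
      rw [hincl, ← sub_eq_zero, ← map_sub, Prod.mk_sub_mk, hf0, zero_sub, map_neg, mul_neg, hd,
        map_sub, map_add]
      ring
    · rintro ⟨y, hy⟩
      obtain ⟨y, rfl⟩ := Ideal.Quotient.mk_surjective y
      rw [← hg a b, ← hy, hincl, hg, map_zero]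
  · intro y
    obtain ⟨b, rfl⟩ := Ideal.Quotient.mk_surjective y
    exact ⟨f (0, b), hg 0 b⟩
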